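/- arXiv:2301.11300 — 2 statements merged into one kernel-verified Lean document; each statement's English description precedes it below -/
import Mathlib

section
/- Theorem 3.1, first part (with the constant established by its proof): For a learning rate η ∈ ℝ, let â := a − η·Σ_{i=1}^M g(x_i) be the weight vector after one accumulated-gradient update. Then the total training loss after the update satisfies Σ_{i=1}^M (1/2)(⟨â, x_i⟩ − y_i)² ≤ G/2 − (η/2)·M²·(2 − η·M)·Σ_{j=1}^d μ_j². In particular, the larger the squared mean gradients Σ_j μ_j², the smaller the loss upper bound (the bound is meaningful for 0 < η < 2/M). -/
open scoped RealInnerProductSpace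

/-- Theorem 3.1 (first part): one accumulated-gradient step with learning rate `η`
gives total loss at most `G/2 − (η/2)·M²·(2 − η·M)·∑ⱼ μⱼ²`. -/
theorem loss_bound_mean_gradients
    (d M : ℕ) (hd : 1 ≤ d) (hM : 1 ≤ M)
    (x : Fin M → EuclideanSpace ℝ (Fin d)) (hx : ∀ i, ‖x i‖ = 1)
    (y : Fin M → ℝ) (a : EuclideanSpace ℝ (Fin d))
    (g : Fin M → EuclideanSpace ℝ (Fin d))
    (hg : ∀ i, g i = (⟪a, x i⟫ - y i) • x i)
    (μ : Fin d → ℝ) (hμ : ∀ j, μ j = (1 / (M : ℝ)) * ∑ i, g i j)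
    (G : ℝ) (hG : G = ∑ i, ∑ j, (g i j) ^ 2)
    (η : ℝ) (ahat : EuclideanSpace ℝ (Fin d))
    (hahat : ahat = a - η • ∑ i, g i) :
    ∑ i, (1 / 2 : ℝ) * (⟪ahat, x i⟫ - y i) ^ 2 ≤
      G / 2 - (η / 2) * (M : ℝ) ^ 2 * (2 - η * M) * ∑ j, (μ j) ^ 2 := by
  have hM0 : (M : ℝ) ≠ 0 := by
    have : (0 : ℝ) < M := by exact_mod_cast hM
    exact this.ne'
  obtain ⟨S, hS⟩ : ∃ S, S = ∑ i, g i := ⟨_, rfl⟩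
  have hSj : ∀ j, S j = ∑ i, g i j := by
    intro j
    rw [hS]
    simp
  have hnorm : ∀ v : EuclideanSpace ℝ (Fin d), ∑ j, (v j) ^ 2 = ‖v‖ ^ 2 := by
    intro v
    rw [EuclideanSpace.real_norm_sq_eq]
  have hmu : (M : ℝ) ^ 2 * ∑ j, (μ j) ^ 2 = ‖S‖ ^ 2 := by
    rw [← hnorm, Finset.mul_sum]
    refine Finset.sum_congr rfl fun j _ => ?_
    rw [hμ, ← hSj]
    field_simp
  have hG' : G = ∑ i, (⟪a, x i⟫ - y i) ^ 2 := by
    rw [hG]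
    refine Finset.sum_congr rfl fun i _ => ?_
    rw [hnorm, hg, norm_smul, hx, mul_one, Real.norm_eq_abs, sq_abs]
  have hcross : ∑ i, (⟪a, x i⟫ - y i) * ⟪S, x i⟫ = ‖S‖ ^ 2 := by
    rw [← real_inner_self_eq_norm_sq]
    conv_rhs => rw [hS, inner_sum, ← hS]
    refine Finset.sum_congr rfl fun i _ => ?_
    rw [hg, real_inner_smul_right]
  have hcs : ∑ i, ⟪S, x i⟫ ^ 2 ≤ M * ‖S‖ ^ 2 := by
    have : ∀ i ∈ Finset.univ, ⟪S, x i⟫ ^ 2 ≤ ‖S‖ ^ 2 := by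
      intro i _
      have h := abs_real_inner_le_norm S (x i)
      rw [hx, mul_one] at h
      exact sq_le_sq' (abs_le.mp h).1 (abs_le.mp h).2
    simpa using Finset.sum_le_sum this
  have hexp : ∑ i, (1 / 2 : ℝ) * (⟪ahat, x i⟫ - y i) ^ 2 =
      G / 2 - η * ‖S‖ ^ 2 + η ^ 2 / 2 * ∑ i, ⟪S, x i⟫ ^ 2 := by
    rw [← hcross, hG', Finset.mul_sum, Finset.mul_sum, Finset.sum_div,
      ← Finset.sum_sub_distrib, ← Finset.sum_add_distrib]
    refine Finset.sum_congr rfl fun i _ => ?_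
    rw [hahat, ← hS, inner_sub_left, real_inner_smul_left]
    ring
  have hfin := mul_le_mul_of_nonneg_left hcs (by positivity : (0 : ℝ) ≤ η ^ 2 / 2)
  have hr : (η / 2) * (M : ℝ) ^ 2 * (2 - η * M) * ∑ j, (μ j) ^ 2 =
      (η / 2) * (2 - η * M) * ‖S‖ ^ 2 := by
    rw [← hmu]
    ring
  rw [hexp, hr]
  linarith
end

section
/- Theorem 3.1, second part: With learning rate η = 1/M, i.e. â := a − (1/M)·Σ_{i=1}^M g(x_i), the total training loss after the update satisfies Σ_{i=1}^M (1/2)(⟨â, x_i⟩ − y_i)² ≤ (M/2)·Σ_{j=1}^d σ_j². In particular, the smaller the coordinatewise variance of the gradients across the training samples, the smaller the loss upper bound. -/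
open scoped RealInnerProductSpace

/-- Theorem 3.1 (second part): with learning rate `η = 1/M`, the total loss after one
accumulated-gradient step is at most `(M/2)·∑ⱼ σⱼ²`. -/
theorem loss_bound_variance_gradients
    (d M : ℕ) (hd : 1 ≤ d) (hM : 1 ≤ M)
    (x : Fin M → EuclideanSpace ℝ (Fin d)) (hx : ∀ i, ‖x i‖ = 1)
    (y : Fin M → ℝ) (a : EuclideanSpace ℝ (Fin d))
    (g : Fin M → EuclideanSpace ℝ (Fin d))
    (hg : ∀ i, g i = (⟪a, x i⟫ - y i) • x i)
    (μ : Fin d → ℝ) (hμ : ∀ j, μ j = (1 / (M : ℝ)) * ∑ i, g i j)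
    (σsq : Fin d → ℝ) (hσsq : ∀ j, σsq j = (1 / (M : ℝ)) * ∑ i, (g i j - μ j) ^ 2)
    (ahat : EuclideanSpace ℝ (Fin d))
    (hahat : ahat = a - (1 / (M : ℝ)) • ∑ i, g i) :
    ∑ i, (1 / 2 : ℝ) * (⟪ahat, x i⟫ - y i) ^ 2 ≤ ((M : ℝ) / 2) * ∑ j, σsq j := by
  have hM0 : (M : ℝ) ≠ 0 := by
    have : M ≠ 0 := by omega
    exact_mod_cast this
  set m : EuclideanSpace ℝ (Fin d) := (1 / (M : ℝ)) • ∑ i, g i with hm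
  have hmj : ∀ j, m j = μ j := by
    intro j
    rw [hμ, hm]
    simp
  have key : ∀ i, (⟪ahat, x i⟫ - y i) ^ 2 ≤ ∑ j, (g i j - μ j) ^ 2 := by
    intro i
    have h1 : ⟪ahat, x i⟫ - y i = ⟪g i - m, x i⟫ := by
      rw [hahat, inner_sub_left, inner_sub_left, hg i, real_inner_smul_left (x i) (x i),
        real_inner_self_eq_norm_sq, hx i]
      ring
    have h2 : |⟪g i - m, x i⟫| ≤ ‖g i - m‖ := by
      have := abs_real_inner_le_norm (g i - m) (x i)
      rwa [hx i, mul_one] at this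
    have h3 : ‖g i - m‖ ^ 2 = ∑ j, (g i j - μ j) ^ 2 := by
      rw [EuclideanSpace.real_norm_sq_eq]
      simp [hmj]
    rw [h1, ← h3, ← sq_abs]
    gcongr
  have hR : ((M : ℝ) / 2) * ∑ j, σsq j = ∑ i, (1 / 2 : ℝ) * ∑ j, (g i j - μ j) ^ 2 := by
    simp only [hσsq]
    rw [← Finset.mul_sum, ← Finset.mul_sum, Finset.sum_comm]
    field_simp
  rw [hR]
  exact Finset.sum_le_sum fun i _ => mul_le_mul_of_nonneg_left (key i) (by norm_num)
end
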